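/- For all integers m, n, t > 0, every integer i with 1 ≤ i ≤ m−1, and all integers a, b ≥ 0 with a + b ≤ n−t, the number of paths P ∈ D(m,n,t) with val(P,i) = a and ret(P) = b satisfies n · #{P ∈ D(m,n,t) : val(P,i) = a and ret(P) = b} = (t+b)·C(n, a)·C(mn−t−b−1, n−t−a−b), as an identity of integers. -/

import Mathlib

/-- A step of a lattice path: north `(0,1)`, east `(1,0)` or diagonal `(1,1)`. -/
inductive Step : Type
  | N : Step
  | E : Step
  | D : Step
  deriving DecidableEq

/-- The displacement vector of a step. -/
def stepVec : Step → ℤ × ℤ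
  | .N => (0, 1)
  | .E => (1, 0)
  | .D => (1, 1)

/-- The lattice point reached after the first `k` steps of the path `P` (starting at the
origin). -/
def pt (P : List Step) (k : ℕ) : ℤ × ℤ := ((P.take k).map stepVec).sum

/-- The path `P` starts with at least `t` north steps. -/
def StartsNorth (t : ℤ) (P : List Step) : Prop := List.replicate t.toNat Step.N <+: P

/-- The path `P` stays weakly above the line `x = m·y`. -/
def AboveLine (m : ℤ) (P : List Step) : Prop := ∀ k : ℕ, (pt P k).1 ≤ m * (pt P k).2

/-- An `(m,t)`-Schröder path of height `n`: a lattice path from `(0,0)` to `(mn,n)` using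
north, east and diagonal steps, starting with at least `t` north steps and never going
below the line `x = m·y`. -/
def IsSchroeder (m n t : ℤ) (P : List Step) : Prop :=
  StartsNorth t P ∧ pt P P.length = (m * n, n) ∧ AboveLine m P

/-- An `(m,t)`-Dyck path of height `n`: an `(m,t)`-Schröder path of height `n` with no
diagonal steps. -/
def IsDyck (m n t : ℤ) (P : List Step) : Prop :=
  IsSchroeder m n t P ∧ ∀ s ∈ P, s ≠ Step.D

/-- A Schröder path is small if none of its diagonal steps starts on the line `x = m·y`. -/
def IsSmall (m : ℤ) (P : List Step) : Prop :=
  ∀ j : ℕ, P[j]? = some Step.D → (pt P j).1 ≠ m * (pt P j).2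

/-- A Schröder path is positive if it touches the line `x = m·y` only at its two
endpoints. -/
def IsPositive (m : ℤ) (P : List Step) : Prop :=
  ∀ k : ℕ, 0 < k → k < P.length → (pt P k).1 ≠ m * (pt P k).2

/-- The set of indices `j` such that the `j`-th step of `P` is east and the `(j+1)`-st is
north; the corresponding valley point is `pt P (j+1)`. -/
def valleys (P : List Step) : Finset ℕ :=
  (Finset.range P.length).filter fun j => P[j]? = some Step.E ∧ P[j + 1]? = some Step.N

/-- The number of valleys of `P`. -/
def val (P : List Step) : ℕ := (valleys P).card

/-- The number of valleys of `P` whose `x`-coordinate is congruent to `i` modulo `m`. -/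
def ival (m i : ℤ) (P : List Step) : ℕ :=
  ((valleys P).filter fun j => (pt P (j + 1)).1 % m = i % m).card

/-- The set of returns of `P`: valleys of the form `(m·i, i)`. -/
def returns (m : ℤ) (P : List Step) : Finset ℕ :=
  (valleys P).filter fun j => (pt P (j + 1)).1 = m * (pt P (j + 1)).2

/-- The number of returns of `P`. -/
def ret (m : ℤ) (P : List Step) : ℕ := (returns m P).card

/-- The set of indices of diagonal steps of `P`. -/
def diags (P : List Step) : Finset ℕ :=
  (Finset.range P.length).filter fun j => P[j]? = some Step.D

/-- The number of diagonal steps of `P`. -/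
def dg (P : List Step) : ℕ := (diags P).card

/-- A Schröder path is `m`-divisible if every diagonal step ends at an `x`-coordinate
divisible by `m`. -/
def MDivisible (m : ℤ) (P : List Step) : Prop :=
  ∀ j ∈ diags P, m ∣ (pt P (j + 1)).1

/-- The number of cornered diagonal steps of `P`: diagonal steps connecting `(i·m − 1, i)`
to `(i·m, i + 1)` for some `i`. -/
def cd (m : ℤ) (P : List Step) : ℕ :=
  ((diags P).filter fun j => (pt P (j + 1)).1 = m * ((pt P (j + 1)).2 - 1)).card

/-- The generalized binomial coefficient `C(p,q) = p(p−1)⋯(p−q+1)/q!` for integers `p` and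
`q ≥ 0`, and `C(p,q) = 0` for `q < 0`. -/
def C (p q : ℤ) : ℤ :=
  if q < 0 then 0
  else if 0 ≤ p then (p.toNat.choose q.toNat : ℤ)
  else (-1) ^ q.toNat * ((q - p - 1).toNat.choose q.toNat : ℤ)

open PowerSeries in
/-- The generating series, by number of steps, of walks with step series `φ` (shifted down by one)
that reach `0` for the first time after `N` steps; the coefficient of `X ^ d` counts those
that start at height `N - d`. -/
noncomputable def hittingSeries {R : Type*} [CommRing R] (φ : R⟦X⟧) : ℕ → R⟦X⟧
  | 0 => 1
  | N + 1 => PowerSeries.mk fun d =>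
      if d ≤ N then PowerSeries.coeff d (φ * hittingSeries φ N) else 0

open PowerSeries in
theorem coeff_derivative_pow {R : Type*} [CommRing R] (φ : R⟦X⟧) (N d : ℕ) :
    ((N : R) + 1) * ∑ x ∈ Finset.HasAntidiagonal.antidiagonal d,
      (x.1 : R) * (coeff x.1 φ * coeff x.2 (φ ^ N)) = d * coeff d (φ ^ (N + 1)) := by
  have key : d⁄dX R (φ ^ (N + 1)) = ((N : R⟦X⟧) + 1) * (d⁄dX R φ * φ ^ N) := by
    rw [Derivation.leibniz_pow]
    simp only [nsmul_eq_mul, smul_eq_mul, Nat.add_sub_cancel]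
    push_cast
    ring
  cases d with
  | zero => simp
  | succ d =>
    have h := congrArg (coeff d) key
    rw [coeff_derivative, show ((N : R⟦X⟧) + 1) = PowerSeries.C ((N : R) + 1) by simp, coeff_C_mul,
      coeff_mul] at h
    rw [Finset.Nat.sum_antidiagonal_succ]
    simp only [Nat.cast_zero, zero_mul, zero_add]
    rw [mul_comm, Nat.cast_succ, mul_comm ((d : R) + 1), h, mul_comm]
    congr 1
    refine Finset.sum_congr rfl fun x _ => ?_
    rw [coeff_derivative]
    push_cast
    ring

open PowerSeries in
/-- The hitting time theorem. -/
theorem hittingSeries_formula {R : Type*} [CommRing R] [IsDomain R] [CharZero R] (φ : R⟦X⟧)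
    (N d : ℕ) (hd : d ≤ N) :
    (N : R) * coeff d (hittingSeries φ N) = ((N : R) - d) * coeff d (φ ^ N) := by
  induction N generalizing d with
  | zero => obtain rfl : d = 0 := by omega
            simp
  | succ N ih =>
    rcases Nat.lt_or_ge N d with h | h
    · obtain rfl : d = N + 1 := by omega
      simp [hittingSeries]
    · rcases Nat.eq_zero_or_pos N with rfl | hN
      · obtain rfl : d = 0 := by omega
        simp [hittingSeries]
      · have hN' : (N : R) ≠ 0 := by exact_mod_cast hN.ne'
        have e1 : coeff d (hittingSeries φ (N + 1)) = coeff d (φ * hittingSeries φ N) := by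
          simp [hittingSeries, h]
        have e2 : (N : R) * coeff d (φ * hittingSeries φ N) =
            ((N : R) - d) * coeff d (φ ^ (N + 1)) + ∑ x ∈ Finset.HasAntidiagonal.antidiagonal d,
              (x.1 : R) * (coeff x.1 φ * coeff x.2 (φ ^ N)) := by
          rw [pow_succ' φ N, coeff_mul, coeff_mul, Finset.mul_sum, Finset.mul_sum,
            ← Finset.sum_add_distrib]
          refine Finset.sum_congr rfl fun x hx => ?_
          have hx' : x.1 + x.2 = d := by simpa using hx
          have := ih x.2 (by omega)
          rw [mul_left_comm, this, ← hx']
          push_cast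
          ring
        apply mul_left_cancel₀ hN'
        rw [e1]
        push_cast
        linear_combination ((N : R) + 1) * e2 + coeff_derivative_pow φ N d

/-- The geometric series, which enumerates the possible numbers of north steps in a column. -/
noncomputable def columnSeries : PowerSeries (Polynomial ℤ) := PowerSeries.mk 1

/-- The series of a column in which a nonzero number of north steps is marked by the
polynomial variable. -/
noncomputable def markedColumnSeries : PowerSeries (Polynomial ℤ) :=
  1 + PowerSeries.C Polynomial.X * (PowerSeries.X * columnSeries)

theorem columnSeries_eq : columnSeries = 1 + PowerSeries.X * columnSeries := by
  ext d : 1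
  cases d <;> simp [columnSeries, PowerSeries.coeff_succ_X_mul, PowerSeries.coeff_one]

/-- The series of `m` consecutive columns, one of which is marked. -/
noncomputable def blockSeries (m : ℕ) : PowerSeries (Polynomial ℤ) :=
  columnSeries ^ (m - 1) * markedColumnSeries

theorem blockSeries_pow_coeff (m n a d : ℕ) (hm : 2 ≤ m) (hn : 1 ≤ n) :
    (PowerSeries.coeff d (blockSeries m ^ n)).coeff a =
      if a ≤ d then (n.choose a : ℤ) * ((m * n - n + d - 1).choose (d - a) : ℤ) else 0 := by
  have h1 : columnSeries * (1 - PowerSeries.X) = 1 := by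
    linear_combination columnSeries_eq
  have h2 : markedColumnSeries = columnSeries *
      (PowerSeries.C Polynomial.X * PowerSeries.X + (1 - PowerSeries.X)) := by
    unfold markedColumnSeries
    linear_combination -h1
  have h3 : blockSeries m = columnSeries ^ m *
      (PowerSeries.C Polynomial.X * PowerSeries.X + (1 - PowerSeries.X)) := by
    unfold blockSeries
    rw [h2, ← mul_assoc, ← pow_succ, Nat.sub_add_cancel (by omega)]
  have hmn : n + 1 ≤ m * n := by nlinarith
  have h4 : blockSeries m ^ n = ∑ k ∈ Finset.range (n + 1),
      PowerSeries.C (Polynomial.X ^ k * (n.choose k : Polynomial ℤ)) *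
        (PowerSeries.X ^ k * columnSeries ^ (m * n - n + k - 1 + 1)) := by
    rw [h3, mul_pow, add_pow, Finset.mul_sum]
    refine Finset.sum_congr rfl fun k hk => ?_
    have hk' : k ≤ n := by simpa [Nat.lt_succ_iff] using hk
    have h5 : (columnSeries ^ m) ^ n * (1 - PowerSeries.X) ^ (n - k) =
        columnSeries ^ (m * n - n + k - 1 + 1) := by
      rw [← pow_mul, show m * n = (m * n - n + k - 1 + 1) + (n - k) by omega, pow_add, mul_assoc,
        ← mul_pow, h1, one_pow, mul_one]
      congr 1
      omega
    rw [← h5]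
    simp only [map_mul, map_pow, map_natCast, mul_pow]
    ring
  have h6 : ∀ k, (PowerSeries.coeff d (PowerSeries.C (Polynomial.X ^ k *
      (n.choose k : Polynomial ℤ)) *
        (PowerSeries.X ^ k * columnSeries ^ (m * n - n + k - 1 + 1)))).coeff a =
      if a = k then (if a ≤ d then
        (n.choose a : ℤ) * ((m * n - n + d - 1).choose (d - a) : ℤ) else 0) else 0 := by
    intro k
    rw [PowerSeries.coeff_C_mul, PowerSeries.coeff_X_pow_mul', columnSeries,
      PowerSeries.mk_one_pow_eq_mk_choose_add]
    by_cases hkd : k ≤ d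
    · rw [if_pos hkd, PowerSeries.coeff_mk, mul_assoc, Polynomial.coeff_X_pow_mul',
        ← Nat.cast_mul, Polynomial.coeff_natCast_ite]
      have : (m * n - n + k - 1 + (d - k)).choose (m * n - n + k - 1) =
          (m * n - n + d - 1).choose (d - k) := by
        rw [show m * n - n + d - 1 = m * n - n + k - 1 + (d - k) by omega]
        exact Nat.choose_symm_add
      by_cases hak : a = k
      · subst hak
        simp [hkd, this]
      · have : k ≤ a → ¬ (a - k = 0) := by omega
        by_cases hka : k ≤ a
        · simp [hak, hka, this hka]
        · simp [hak, hka]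
    · by_cases hak : a = k
      · subst hak
        simp [hkd]
      · simp [hkd, hak]
  rw [h4, map_sum, Polynomial.finsetSum_coeff, Finset.sum_congr rfl fun k _ => h6 k,
    Finset.sum_ite_eq]
  by_cases han : a ∈ Finset.range (n + 1)
  · rw [if_pos han]
  · rw [if_neg han, Nat.choose_eq_zero_of_lt (by simpa using han)]
    simp

/-- The series enumerating the last `u` columns of a path, where the marked columns are those
at distance `e` modulo `m` from the end. -/
noncomputable def tailSeries (m e u : ℕ) : PowerSeries (Polynomial ℤ) :=
  (if u % m < e then columnSeries ^ (u % m)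
    else columnSeries ^ (u % m - 1) * markedColumnSeries) *
    hittingSeries (blockSeries m) (u / m)

theorem succ_mod_div_of_ne {m u : ℕ} (hm : 0 < m) (h : (u + 1) % m ≠ 0) :
    (u + 1) % m = u % m + 1 ∧ (u + 1) / m = u / m := by
  have h1 := Nat.mod_add_div u m
  have h2 := Nat.mod_lt u hm
  have h3 : u + 1 = (u % m + 1) + m * (u / m) := by omega
  rcases Nat.lt_or_ge (u % m + 1) m with h4 | h4
  · constructor
    · rw [h3, Nat.add_mul_mod_self_left, Nat.mod_eq_of_lt h4]
    · rw [h3, Nat.add_mul_div_left _ _ hm, Nat.div_eq_of_lt h4]; omega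
  · exfalso
    apply h
    rw [h3, Nat.add_mul_mod_self_left, show u % m + 1 = m by omega, Nat.mod_self]

theorem tailSeries_succ_marked {m e u : ℕ} (he : 1 ≤ e) (hem : e < m) (h : (u + 1) % m = e) :
    tailSeries m e (u + 1) = markedColumnSeries * tailSeries m e u := by
  obtain ⟨h1, h2⟩ := succ_mod_div_of_ne (m := m) (u := u) (by omega) (by omega)
  unfold tailSeries
  rw [h2, h, if_neg (lt_irrefl _), if_pos (by omega), show u % m = e - 1 by omega]
  ring

theorem tailSeries_succ_unmarked {m e u : ℕ} (he : 1 ≤ e) (hem : e < m) (h : (u + 1) % m ≠ e)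
    (h0 : (u + 1) % m ≠ 0) :
    tailSeries m e (u + 1) = columnSeries * tailSeries m e u := by
  obtain ⟨h1, h2⟩ := succ_mod_div_of_ne (m := m) (u := u) (by omega) h0
  unfold tailSeries
  rw [h2, h1]
  by_cases h3 : u % m < e
  · rw [if_pos h3, if_pos (by omega)]
    ring
  · rw [if_neg h3, if_neg (by omega), Nat.add_sub_cancel]
    obtain ⟨k, hk⟩ : ∃ k, u % m = k + 1 := ⟨u % m - 1, by omega⟩
    rw [hk, Nat.add_sub_cancel]
    ring

theorem coeff_tailSeries_mul {m e N u : ℕ} (he : 1 ≤ e) (hem : e < m) (hu : u + 1 = m * N)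
    (d : ℕ) :
    PowerSeries.coeff d (tailSeries m e (u + 1)) =
      if d < N then PowerSeries.coeff d (columnSeries * tailSeries m e u) else 0 := by
  obtain ⟨N, rfl⟩ : ∃ k, N = k + 1 := ⟨N - 1, by cases N <;> simp_all⟩
  have hu' : u = (m - 1) + m * N := by
    rw [mul_add] at hu
    omega
  have h1 : u % m = m - 1 := by
    rw [hu', Nat.add_mul_mod_self_left, Nat.mod_eq_of_lt (by omega)]
  have h2 : u / m = N := by
    rw [hu', Nat.add_mul_div_left _ _ (by omega), Nat.div_eq_of_lt (by omega), zero_add]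
  have h3 : tailSeries m e (u + 1) = hittingSeries (blockSeries m) (N + 1) := by
    unfold tailSeries
    rw [hu, Nat.mul_mod_right, if_pos (by omega), Nat.mul_div_cancel_left _ (by omega)]
    simp
  have h4 : columnSeries * tailSeries m e u =
      blockSeries m * hittingSeries (blockSeries m) N := by
    unfold tailSeries
    rw [h1, h2, if_neg (by omega), blockSeries, ← mul_assoc, ← mul_assoc, ← pow_succ',
      show m - 1 - 1 + 1 = m - 1 by omega]
  rw [h3, h4]
  simp [hittingSeries]

/-- `Q` uses `u` east and `v` north steps, and stays weakly above the line of slope `1 / m`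
through its endpoint (its starting point excepted). -/
def IsTail (m : ℕ) : ℕ → ℕ → List Step → Prop
  | u, v, [] => u = 0 ∧ v = 0
  | u, v, .N :: Q => ∃ v', v = v' + 1 ∧ IsTail m u v' Q
  | u, v, .E :: Q => ∃ u', u = u' + 1 ∧ m * v ≤ u' ∧ IsTail m u' v Q
  | _, _, .D :: _ => False

/-- The number of valleys at distance `e` modulo `m` from the end of a path with `u` east steps;
`l` records whether the path is preceded by an east step. -/
def tailMarked (m e : ℕ) : Bool → ℕ → List Step → ℕ
  | _, _, [] => 0
  | l, u, .N :: Q => (if l ∧ u % m = e then 1 else 0) + tailMarked m e false u Q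
  | _, u, .E :: Q => tailMarked m e true (u - 1) Q
  | _, _, .D :: _ => 0

/-- The number of returns of a path with `u` east and `v` north steps; `l` records whether the
path is preceded by an east step. -/
def tailReturns (m : ℕ) : Bool → ℕ → ℕ → List Step → ℕ
  | _, _, _, [] => 0
  | l, u, v, .N :: Q => (if l ∧ u = m * v then 1 else 0) + tailReturns m false u (v - 1) Q
  | _, u, v, .E :: Q => tailReturns m true (u - 1) v Q
  | _, _, _, .D :: _ => 0

/-- The path endings with given numbers of steps, marked valleys and returns. -/
def tails (m e : ℕ) (l : Bool) (u v a b : ℕ) : Set (List Step) :=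
  {Q | IsTail m u v Q ∧ tailMarked m e l u Q = a ∧ tailReturns m l u v Q = b}

/-- `T` is finite with `c` elements. -/
def HasCard (T : Set (List Step)) (c : ℤ) : Prop := T.Finite ∧ (T.ncard : ℤ) = c

theorem hasCard_empty : HasCard ∅ 0 := ⟨Set.finite_empty, by simp⟩

theorem HasCard.of_cons {T : Set (List Step)} {c₁ c₂ c : ℤ} (hnil : [] ∉ T)
    (hD : ∀ Q, Step.D :: Q ∉ T) (hN : HasCard {Q | Step.N :: Q ∈ T} c₁)
    (hE : HasCard {Q | Step.E :: Q ∈ T} c₂) (hc : c = c₁ + c₂) : HasCard T c := by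
  have hT : T = (Step.N :: ·) '' {Q | Step.N :: Q ∈ T} ∪
      (Step.E :: ·) '' {Q | Step.E :: Q ∈ T} := by
    ext Q
    rcases Q with _ | ⟨_ | _ | _, Q⟩ <;> simp [hnil, hD]
  have hdisj : Disjoint ((Step.N :: ·) '' {Q | Step.N :: Q ∈ T})
      ((Step.E :: ·) '' {Q | Step.E :: Q ∈ T}) := by
    rw [Set.disjoint_left]
    rintro _ ⟨Q, -, rfl⟩ ⟨Q', -, h⟩
    simp at h
  refine ⟨hT ▸ (hN.1.image _).union (hE.1.image _), ?_⟩
  rw [hT, Set.ncard_union_eq hdisj (hN.1.image _) (hE.1.image _),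
    Set.ncard_image_of_injective _ List.cons_injective,
    Set.ncard_image_of_injective _ List.cons_injective, Nat.cast_add, hN.2, hE.2, hc]

/-- The coefficient predicted for the number of path endings with `v` north steps, `a` marked
valleys and `b` returns. -/
noncomputable def tailCoeff (F : PowerSeries (Polynomial ℤ)) (v a b : ℕ) : ℤ :=
  if b ≤ v then (PowerSeries.coeff (v - b) F).coeff a else 0

theorem coeff_columnSeries_mul_zero (F : PowerSeries (Polynomial ℤ)) :
    PowerSeries.coeff 0 (columnSeries * F) = PowerSeries.coeff 0 F := by
  conv_lhs => rw [columnSeries_eq]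
  rw [add_mul, one_mul, mul_assoc, map_add]
  simp

theorem coeff_columnSeries_mul_succ (F : PowerSeries (Polynomial ℤ)) (d : ℕ) :
    PowerSeries.coeff (d + 1) (columnSeries * F) =
      PowerSeries.coeff d (columnSeries * F) + PowerSeries.coeff (d + 1) F := by
  conv_lhs => rw [columnSeries_eq]
  rw [add_mul, one_mul, mul_assoc, map_add, PowerSeries.coeff_succ_X_mul, add_comm]

theorem tailCoeff_columnSeries_mul_zero (F : PowerSeries (Polynomial ℤ)) (a b : ℕ) :
    tailCoeff (columnSeries * F) 0 a b = tailCoeff F 0 a b := by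
  unfold tailCoeff
  split_ifs with h
  · rw [Nat.zero_sub, coeff_columnSeries_mul_zero]
  · rfl

theorem tailCoeff_columnSeries_mul_succ (F : PowerSeries (Polynomial ℤ)) (v a b : ℕ) :
    tailCoeff (columnSeries * F) (v + 1) a b =
      tailCoeff (columnSeries * F) v a b + tailCoeff F (v + 1) a b := by
  unfold tailCoeff
  rcases Nat.lt_trichotomy b (v + 1) with h | rfl | h
  · rw [if_pos (by omega), if_pos (by omega), if_pos (by omega),
      show v + 1 - b = v - b + 1 by omega, coeff_columnSeries_mul_succ, Polynomial.coeff_add]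
  · simp [coeff_columnSeries_mul_zero]
  · rw [if_neg (by omega), if_neg (by omega), if_neg (by omega), add_zero]

theorem tailCoeff_marked_mul_zero (F : PowerSeries (Polynomial ℤ)) (a b : ℕ) :
    tailCoeff (markedColumnSeries * F) 0 a b = tailCoeff F 0 a b := by
  unfold tailCoeff markedColumnSeries
  split_ifs with h
  · simp [add_mul, mul_assoc]
  · rfl

theorem tailCoeff_marked_mul_succ (F : PowerSeries (Polynomial ℤ)) (v a b : ℕ) :
    tailCoeff (markedColumnSeries * F) (v + 1) a b =
      (if 1 ≤ a then tailCoeff (columnSeries * F) v (a - 1) b else 0) +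
        tailCoeff F (v + 1) a b := by
  have h1 : markedColumnSeries * F =
      F + PowerSeries.C Polynomial.X * (PowerSeries.X * (columnSeries * F)) := by
    unfold markedColumnSeries
    ring
  unfold tailCoeff
  rw [h1]
  rcases Nat.lt_trichotomy b (v + 1) with h | rfl | h
  · rw [if_pos (show b ≤ v + 1 by omega), if_pos (show b ≤ v by omega),
      if_pos (show b ≤ v + 1 by omega), show v + 1 - b = v - b + 1 by omega, map_add,
      PowerSeries.coeff_C_mul, PowerSeries.coeff_succ_X_mul, Polynomial.coeff_add, add_comm]
    cases a <;> simp [Polynomial.coeff_X_mul]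
  · simp
  · simp [show ¬ b ≤ v + 1 by omega, show ¬ b ≤ v by omega]

/-- The tail counts following an east step determine those following a north step. -/
theorem hasCard_tails_false {m e u : ℕ} (hm : 0 < m) {F : PowerSeries (Polynomial ℤ)}
    (h : ∀ v a b, m * v ≤ u → HasCard (tails m e true u v a b) (tailCoeff F v a b))
    (v a b : ℕ) (hv : m * (v + 1) ≤ u + 1) :
    HasCard (tails m e false (u + 1) v a b) (tailCoeff (columnSeries * F) v a b) := by
  have hv' : m * v ≤ u := by
    rw [mul_add] at hv
    omega
  have hE : {Q | Step.E :: Q ∈ tails m e false (u + 1) v a b} = tails m e true u v a b := by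
    ext Q
    simp [tails, IsTail, tailMarked, tailReturns, hv']
  induction v generalizing a b with
  | zero =>
    refine HasCard.of_cons (c₁ := 0) (c₂ := tailCoeff F 0 a b) (by simp [tails, IsTail])
      (by simp [tails, IsTail]) ?_ (hE ▸ h 0 a b hv')
      (by rw [tailCoeff_columnSeries_mul_zero, zero_add])
    convert hasCard_empty
    ext Q
    simp [tails, IsTail]
  | succ v ih =>
    have hv1 : m * (v + 1) ≤ u + 1 := by omega
    have hv2 : m * v ≤ u := by
      rw [mul_add] at hv1
      omega
    refine HasCard.of_cons (c₁ := tailCoeff (columnSeries * F) v a b)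
      (c₂ := tailCoeff F (v + 1) a b) (by simp [tails, IsTail])
      (by simp [tails, IsTail]) ?_ (hE ▸ h (v + 1) a b hv')
      (tailCoeff_columnSeries_mul_succ F v a b)
    convert ih a b hv1 hv2 ?_ using 1
    · ext Q
      simp [tails, IsTail, tailMarked, tailReturns]
    · ext Q
      simp [tails, IsTail, tailMarked, tailReturns, hv2]

theorem hasCard_tails_true {m e : ℕ} (he : 1 ≤ e) (hem : e < m) (u v a b : ℕ)
    (hv : m * v ≤ u) :
    HasCard (tails m e true u v a b) (tailCoeff (tailSeries m e u) v a b) := by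
  have hm : 0 < m := by omega
  induction u generalizing v a b with
  | zero =>
    obtain rfl : v = 0 := by
      rcases Nat.eq_zero_or_pos v with h | h
      · exact h
      · have := Nat.mul_pos hm h
        omega
    have h1 : tails m e true 0 0 a b = if a = 0 ∧ b = 0 then {[]} else ∅ := by
      ext Q
      rcases Q with _ | ⟨_ | _ | _, Q⟩ <;>
        split_ifs with h <;> simp [tails, IsTail, tailMarked, tailReturns] <;> omega
    have h2 : tailSeries m e 0 = 1 := by
      simp [tailSeries, hittingSeries, show 0 < e by omega]
    rw [h1, h2]
    unfold tailCoeff HasCard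
    rcases Nat.eq_zero_or_pos b with rfl | hb
    · rcases Nat.eq_zero_or_pos a with rfl | ha
      · simp
      · simp [ha.ne', Polynomial.coeff_one]
    · simp [hb.ne']
  | succ u ih =>
    have hF := hasCard_tails_false hm ih
    rcases Nat.lt_or_ge u (m * v) with huv | huv
    · have huv : u + 1 = m * v := by omega
      obtain ⟨v, rfl⟩ : ∃ k, v = k + 1 := ⟨v - 1, by cases v <;> simp_all⟩
      have hmod : (u + 1) % m = 0 := by rw [huv, Nat.mul_mod_right]
      refine HasCard.of_cons
        (c₁ := if 1 ≤ b then tailCoeff (columnSeries * tailSeries m e u) v a (b - 1) else 0)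
        (c₂ := 0) (by simp [tails, IsTail]) (by simp [tails, IsTail]) ?_ ?_ ?_
      · split_ifs with hb
        · convert hF v a (b - 1) hv using 1
          ext Q
          simp only [tails, IsTail, tailMarked, tailReturns, Set.mem_ofPred_eq, huv]
          simp [show ¬ 0 = e by omega]
          intro _ _
          omega
        · convert hasCard_empty
          ext Q
          simp only [tails, IsTail, tailMarked, tailReturns, Set.mem_ofPred_eq, huv]
          simp
          intro _ _ _
          omega
      · convert hasCard_empty
        ext Q
        simp [tails, IsTail]
        intro _ _
        omega
      · unfold tailCoeff
        rw [coeff_tailSeries_mul he hem huv]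
        by_cases hb : 1 ≤ b
        · rw [if_pos hb, add_zero, if_pos (show v + 1 - b < v + 1 by omega),
            show v + 1 - b = v - (b - 1) by omega]
          exact if_congr (by omega) rfl rfl
        · rw [if_neg hb, if_pos (by omega), if_neg (by omega)]
          simp
    · have hE : {Q | Step.E :: Q ∈ tails m e true (u + 1) v a b} = tails m e true u v a b := by
        ext Q
        simp [tails, IsTail, tailMarked, tailReturns, huv]
      have hN : v = 0 → HasCard {Q | Step.N :: Q ∈ tails m e true (u + 1) v a b} 0 := by
        rintro rfl
        convert hasCard_empty
        ext Q
        simp [tails, IsTail]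
      by_cases hue : (u + 1) % m = e
      · rw [tailSeries_succ_marked he hem hue]
        cases v with
        | zero =>
          exact HasCard.of_cons (by simp [tails, IsTail]) (by simp [tails, IsTail]) (hN rfl)
            (hE ▸ ih 0 a b huv) (by rw [tailCoeff_marked_mul_zero, zero_add])
        | succ v =>
          refine HasCard.of_cons (by simp [tails, IsTail]) (by simp [tails, IsTail]) ?_
            (hE ▸ ih (v + 1) a b huv) (tailCoeff_marked_mul_succ _ v a b)
          split_ifs with ha
          · convert hF v (a - 1) b (by omega) using 1
            ext Q
            simp [tails, IsTail, tailMarked, tailReturns, hue,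
              show u + 1 ≠ m * (v + 1) by omega]
            intro _ _
            omega
          · convert hasCard_empty
            ext Q
            simp [tails, IsTail, tailMarked, tailReturns, hue]
            intros
            omega
      · have hS : tailCoeff (tailSeries m e (u + 1)) v a b =
            tailCoeff (columnSeries * tailSeries m e u) v a b := by
          by_cases h0 : (u + 1) % m = 0
          · obtain ⟨N, hN⟩ := Nat.dvd_of_mod_eq_zero h0
            have hvN : v < N := Nat.lt_of_mul_lt_mul_left (a := m) (by omega)
            unfold tailCoeff
            rw [coeff_tailSeries_mul he hem hN, if_pos (show v - b < N by omega)]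
          · rw [tailSeries_succ_unmarked he hem hue h0]
        rw [hS]
        cases v with
        | zero =>
          exact HasCard.of_cons (by simp [tails, IsTail]) (by simp [tails, IsTail]) (hN rfl)
            (hE ▸ ih 0 a b huv) (by rw [tailCoeff_columnSeries_mul_zero, zero_add])
        | succ v =>
          refine HasCard.of_cons (by simp [tails, IsTail]) (by simp [tails, IsTail]) ?_
            (hE ▸ ih (v + 1) a b huv) (tailCoeff_columnSeries_mul_succ _ v a b)
          convert hF v a b (by omega) using 1
          ext Q
          simp [tails, IsTail, tailMarked, tailReturns, hue,
            show u + 1 ≠ m * (v + 1) by omega]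

theorem pt_cons_succ (s : Step) (P : List Step) (k : ℕ) :
    pt (s :: P) (k + 1) = stepVec s + pt P k := by
  simp [pt]

theorem pt_nonneg (P : List Step) (k : ℕ) : 0 ≤ (pt P k).1 ∧ 0 ≤ (pt P k).2 := by
  induction P generalizing k with
  | nil => simp [pt]
  | cons s P ih =>
    cases k with
    | zero => simp [pt]
    | succ k =>
      rw [pt_cons_succ]
      have := ih k
      cases s <;> simp [stepVec] <;> omega

theorem isTail_iff (m : ℕ) (Q : List Step) (u v : ℕ) :
    IsTail m u v Q ∧ m * v ≤ u ↔
      (∀ k, (m : ℤ) * (v - (pt Q k).2) ≤ u - (pt Q k).1) ∧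
        pt Q Q.length = ((u : ℤ), (v : ℤ)) ∧ ∀ s ∈ Q, s ≠ Step.D := by
  induction Q generalizing u v with
  | nil =>
    simp only [IsTail, pt, List.take_nil, List.map_nil, List.sum_nil, List.not_mem_nil]
    constructor
    · rintro ⟨⟨rfl, rfl⟩, -⟩
      simp [Prod.ext_iff]
    · rintro ⟨-, h, -⟩
      rw [Prod.ext_iff] at h
      simp at h
      obtain ⟨rfl, rfl⟩ : u = 0 ∧ v = 0 := by omega
      simp
  | cons s Q ih =>
    have hall : ∀ c : ℕ → Prop, (∀ k, c k) ↔ c 0 ∧ ∀ k, c (k + 1) :=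
      fun c => ⟨fun h => ⟨h 0, fun k => h _⟩, fun h k => by cases k; exacts [h.1, h.2 _]⟩
    have h0 : ((m : ℤ) * (v - (pt (s :: Q) 0).2) ≤ u - (pt (s :: Q) 0).1) ↔ m * v ≤ u := by
      simp only [pt, List.take_zero, List.map_nil, List.sum_nil, Prod.fst_zero, Prod.snd_zero,
        sub_zero]
      norm_cast
    rw [hall, h0, List.length_cons]
    simp only [pt_cons_succ, List.forall_mem_cons]
    have hn := pt_nonneg Q Q.length
    cases s with
    | D => simp [IsTail]
    | N =>
      simp only [IsTail, stepVec, Prod.fst_add, Prod.snd_add, zero_add]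
      constructor
      · rintro ⟨⟨v, rfl, hQ⟩, hv⟩
        obtain ⟨h1, h2, h3⟩ := (ih u v).1 ⟨hQ, by nlinarith⟩
        refine ⟨⟨hv, fun k => ?_⟩, ?_, by simp, h3⟩
        · convert h1 k using 2
          push_cast
          ring
        · rw [h2]
          ext <;> simp [add_comm]
      · rintro ⟨⟨hv, h1⟩, h2, -, h3⟩
        rw [Prod.ext_iff] at h2
        simp at h2
        obtain ⟨w, rfl⟩ : ∃ w, v = w + 1 := ⟨v - 1, by omega⟩
        refine ⟨⟨w, rfl, ((ih u w).2 ⟨fun k => ?_, ?_, h3⟩).1⟩, hv⟩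
        · convert h1 k using 2
          push_cast
          ring
        · ext <;> push_cast at h2 <;> simp <;> omega
    | E =>
      simp only [IsTail, stepVec, Prod.fst_add, Prod.snd_add, zero_add]
      constructor
      · rintro ⟨⟨u, rfl, hu, hQ⟩, hv⟩
        obtain ⟨h1, h2, h3⟩ := (ih u v).1 ⟨hQ, hu⟩
        refine ⟨⟨hv, fun k => ?_⟩, ?_, by simp, h3⟩
        · convert h1 k using 1
          push_cast
          ring
        · rw [h2]
          ext <;> simp [add_comm]
      · rintro ⟨⟨hv, h1⟩, h2, -, h3⟩
        rw [Prod.ext_iff] at h2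
        simp at h2
        obtain ⟨w, rfl⟩ : ∃ w, u = w + 1 := ⟨u - 1, by omega⟩
        obtain ⟨h4, h5⟩ := (ih w v).2 ⟨fun k => by
          convert h1 k using 1
          push_cast
          ring, by ext <;> push_cast at h2 <;> simp <;> omega, h3⟩
        exact ⟨⟨w, rfl, h5, h4⟩, hv⟩

/-- The number of valleys of a path at points satisfying `p`. -/
def valleyCount (p : ℤ × ℤ → Prop) [DecidablePred p] (P : List Step) : ℕ :=
  ((valleys P).filter fun j => p (pt P (j + 1))).card

theorem valleyCount_cons (p : ℤ × ℤ → Prop) [DecidablePred p] (s : Step) (P : List Step) :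
    valleyCount p (s :: P) =
      (if s = Step.E ∧ P[0]? = some Step.N ∧ p (stepVec s) then 1 else 0) +
        valleyCount (fun z => p (stepVec s + z)) P := by
  unfold valleyCount valleys
  rw [Finset.filter_filter, Finset.filter_filter, Finset.card_filter, Finset.card_filter,
    List.length_cons, Finset.sum_range_succ', add_comm]
  congr 1
  · refine if_congr ?_ rfl rfl
    rw [pt_cons_succ]
    simp [pt, and_assoc]

theorem tailMarked_eq (p : ℤ × ℤ → Prop) [DecidablePred p] (m e : ℕ) (Q : List Step) (l : Bool)
    (u v : ℕ) (hQ : IsTail m u v Q)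
    (hp : ∀ z : ℤ × ℤ, 0 ≤ z.1 → ∀ k : ℕ, (k : ℤ) = u - z.1 → (p z ↔ k % m = e)) :
    tailMarked m e l u Q =
      (if l ∧ Q[0]? = some Step.N ∧ p 0 then 1 else 0) + valleyCount p Q := by
  induction Q generalizing l u v p with
  | nil => simp [tailMarked, valleyCount, valleys]
  | cons s Q ih =>
    rw [valleyCount_cons]
    cases s with
    | D => exact hQ.elim
    | N =>
      obtain ⟨w, rfl, hQ⟩ := hQ
      rw [tailMarked, ih (fun z => p (stepVec .N + z)) false u w hQ
        fun z hz k hk => hp _ (by simpa [stepVec] using hz) k (by simpa [stepVec] using hk)]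
      have := hp 0 le_rfl u (by simp)
      simp [this]
    | E =>
      obtain ⟨w, rfl, -, hQ⟩ := hQ
      rw [tailMarked, Nat.add_sub_cancel, ih (fun z => p (stepVec .E + z)) true w v hQ
        fun z hz k hk => hp _ (by simp [stepVec]; omega) k (by simp [stepVec]; omega)]
      simp

theorem tailReturns_eq (p : ℤ × ℤ → Prop) [DecidablePred p] (m : ℕ) (Q : List Step) (l : Bool)
    (u v : ℕ) (hQ : IsTail m u v Q)
    (hp : ∀ z : ℤ × ℤ, p z ↔ (u : ℤ) - z.1 = m * (v - z.2)) :
    tailReturns m l u v Q =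
      (if l ∧ Q[0]? = some Step.N ∧ p 0 then 1 else 0) + valleyCount p Q := by
  induction Q generalizing l u v p with
  | nil => simp [tailReturns, valleyCount, valleys]
  | cons s Q ih =>
    rw [valleyCount_cons]
    cases s with
    | D => exact hQ.elim
    | N =>
      obtain ⟨w, rfl, hQ⟩ := hQ
      rw [tailReturns, Nat.add_sub_cancel, ih (fun z => p (stepVec .N + z)) false u w hQ
        fun z => by rw [hp]; simp [stepVec, add_sub_add_left_eq_sub, add_comm _ (1 : ℤ)]]
      have : p 0 ↔ u = m * (w + 1) := by
        rw [hp]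
        simp
        norm_cast
      simp [this]
    | E =>
      obtain ⟨w, rfl, -, hQ⟩ := hQ
      rw [tailReturns, Nat.add_sub_cancel, ih (fun z => p (stepVec .E + z)) true w v hQ
        fun z => by rw [hp]; simp [stepVec, add_sub_add_left_eq_sub, add_comm _ (1 : ℤ)]]
      simp

theorem isTail_replicate_append (m t u v : ℕ) (Q : List Step) :
    IsTail m u (v + t) (List.replicate t Step.N ++ Q) ↔ IsTail m u v Q := by
  induction t with
  | zero => simp
  | succ t ih => simp [List.replicate_succ, IsTail, ← add_assoc, ih]

theorem tailMarked_replicate_append (m e t u : ℕ) (Q : List Step) :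
    tailMarked m e false u (List.replicate t Step.N ++ Q) = tailMarked m e false u Q := by
  induction t with
  | zero => simp
  | succ t ih => simp [List.replicate_succ, tailMarked, ih]

theorem tailReturns_replicate_append (m t u v : ℕ) (Q : List Step) :
    tailReturns m false u (v + t) (List.replicate t Step.N ++ Q) =
      tailReturns m false u v Q := by
  induction t with
  | zero => simp
  | succ t ih => simp [List.replicate_succ, tailReturns, ← add_assoc, ih]

theorem emod_eq_iff_mod_eq {m n i k : ℕ} {x : ℤ} (hi : 1 ≤ i) (him : i < m)
    (hx : (k : ℤ) = (m * n : ℕ) - x) : x % m = i % m ↔ k % m = m - i := by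
  have hx' : x = m * n - k := by push_cast at hx; omega
  have h1 := Nat.mod_add_div k m
  have h2 := Nat.mod_lt k (show 0 < m by omega)
  rw [← Int.ModEq, Int.modEq_iff_dvd]
  have h3 : (i : ℤ) - x = ((i + k % m : ℕ) : ℤ) + m * ((k / m : ℕ) - n) := by
    rw [hx']
    conv_lhs => rw [← h1]
    push_cast
    ring
  rw [h3, dvd_add_left (Dvd.intro _ rfl), Int.natCast_dvd_natCast]
  constructor
  · rintro ⟨c, hc⟩
    have : c = 1 := by
      rcases c with _ | _ | c
      · omega
      · rfl
      · exfalso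
        have : m * (c + 1 + 1) = m * c + m + m := by ring
        omega
    subst this
    omega
  · intro h
    rw [h, show i + (m - i) = m by omega]

theorem dyck_eq_image (m n t i a b : ℕ) (hi : 1 ≤ i) (him : i < m) (htn : t ≤ n) :
    {P : List Step | IsDyck m n t P ∧ (ival m i P : ℤ) = a ∧ (ret m P : ℤ) = b} =
      (List.replicate t Step.N ++ ·) '' tails m (m - i) false (m * n) (n - t) a b := by
  have main : ∀ P, ((pt P P.length = ((m : ℤ) * n, (n : ℤ)) ∧ AboveLine m P) ∧
      ∀ s ∈ P, s ≠ Step.D) ↔ IsTail m (m * n) n P := by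
    intro P
    have h := isTail_iff m P (m * n) n
    rw [and_iff_left le_rfl] at h
    rw [h]
    unfold AboveLine
    push_cast
    constructor
    · rintro ⟨⟨h1, h2⟩, h3⟩
      exact ⟨fun k => by have := h2 k; linarith, h1, h3⟩
    · rintro ⟨h1, h2, h3⟩
      exact ⟨⟨h2, fun k => by have := h1 k; linarith⟩, h3⟩
  have hiv : ∀ P, IsTail m (m * n) n P → ival m i P = tailMarked m (m - i) false (m * n) P := by
    intro P hP
    rw [tailMarked_eq (fun z => z.1 % m = i % m) m (m - i) P false (m * n) n hP
      fun z _ k hk => emod_eq_iff_mod_eq hi him hk]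
    simp [ival, valleyCount]
  have hret : ∀ P, IsTail m (m * n) n P → ret m P = tailReturns m false (m * n) n P := by
    intro P hP
    rw [tailReturns_eq (fun z => z.1 = m * z.2) m P false (m * n) n hP fun z => by
      push_cast
      constructor <;> intro h <;> linarith]
    simp [ret, returns, valleyCount]
  ext P
  simp only [Set.mem_image, Set.mem_ofPred_eq, tails]
  constructor
  · rintro ⟨⟨⟨⟨Q, hQ⟩, h1⟩, h2⟩, h3, h4⟩
    have hP := (main P).1 ⟨h1, h2⟩
    rw [hiv P hP] at h3
    rw [hret P hP] at h4
    rw [Int.toNat_natCast] at hQ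
    subst hQ
    refine ⟨Q, ?_, rfl⟩
    obtain ⟨v, rfl⟩ : ∃ v, n = v + t := ⟨n - t, by omega⟩
    rw [tailMarked_replicate_append] at h3
    rw [tailReturns_replicate_append] at h4
    rw [Nat.add_sub_cancel]
    exact ⟨(isTail_replicate_append ..).1 hP, by exact_mod_cast h3, by exact_mod_cast h4⟩
  · rintro ⟨Q, ⟨h1, h2, h3⟩, rfl⟩
    obtain ⟨v, rfl⟩ : ∃ v, n = v + t := ⟨n - t, by omega⟩
    rw [Nat.add_sub_cancel] at h1 h3
    have hP := (isTail_replicate_append m t _ v Q).2 h1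
    rw [hiv _ hP, hret _ hP, tailMarked_replicate_append, tailReturns_replicate_append, h2, h3]
    obtain ⟨h4, h5⟩ := (main _).2 hP
    refine ⟨⟨⟨?_, h4⟩, h5⟩, rfl, rfl⟩
    unfold StartsNorth
    rw [Int.toNat_natCast]
    exact List.prefix_append _ _

theorem ncard_dyck (m n t i a b : ℕ) (ht : 1 ≤ t) (hi : 1 ≤ i) (him : i < m)
    (hab : a + b + t ≤ n) :
    (n : ℤ) * ({P : List Step | IsDyck m n t P ∧ (ival m i P : ℤ) = a ∧
        (ret m P : ℤ) = b}.ncard : ℤ) =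
      (t + b) * n.choose a * (m * n - t - b - 1).choose (n - t - a - b) := by
  have hmn : m * n ≠ 0 := Nat.mul_ne_zero (by omega) (by omega)
  obtain ⟨u, hu⟩ : ∃ u, m * n = u + 1 := ⟨m * n - 1, by omega⟩
  have hcard := hasCard_tails_false (e := m - i) (by omega)
    (hasCard_tails_true (m := m) (e := m - i) (by omega) (by omega) u) (n - t) a b
    (hu ▸ Nat.mul_le_mul_left _ (by omega))
  rw [← hu] at hcard
  rw [dyck_eq_image m n t i a b hi him (by omega),
    Set.ncard_image_of_injective _ (List.append_right_injective _), hcard.2]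
  have hd : n - t - b < n := by omega
  have h1 := coeff_tailSeries_mul (m := m) (e := m - i) (by omega) (by omega) hu.symm (n - t - b)
  rw [if_pos hd, ← hu] at h1
  have h2 : tailSeries m (m - i) (m * n) = hittingSeries (blockSeries m) n := by
    unfold tailSeries
    rw [Nat.mul_mod_right, if_pos (by omega), Nat.mul_div_cancel_left _ (by omega)]
    simp
  have h3 := congrArg (Polynomial.coeff · a)
    (hittingSeries_formula (blockSeries m) n (n - t - b) hd.le)
  have h4 : (n : Polynomial ℤ) - (n - t - b : ℕ) = ((t + b : ℕ) : Polynomial ℤ) := by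
    rw [sub_eq_iff_eq_add, ← Nat.cast_add, show t + b + (n - t - b) = n by omega]
  simp only [h4, Polynomial.coeff_natCast_mul] at h3
  have hmn' : 2 * n ≤ m * n := Nat.mul_le_mul_right _ (by omega)
  rw [tailCoeff, if_pos (by omega), ← h1, h2, h3,
    blockSeries_pow_coeff m n a _ (by omega) (by omega), if_pos (by omega),
    show m * n - n + (n - t - b) - 1 = m * n - t - b - 1 by omega,
    show n - t - b - a = n - t - a - b by omega]
  push_cast
  ring

theorem C_natCast (p q : ℕ) : C p q = p.choose q := by
  simp [C]

/-- the number of `(m,t)`-Dyck paths of height `n` with `a` `i`-valleys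
(`1 ≤ i ≤ m−1`) and `b` returns. -/
theorem statement3 (m n t i a b : ℤ) (hm : 0 < m) (hn : 0 < n) (ht : 0 < t)
    (hi1 : 1 ≤ i) (him : i ≤ m - 1) (ha : 0 ≤ a) (hb : 0 ≤ b) (hab : a + b ≤ n - t) :
    n * (({P : List Step | IsDyck m n t P ∧ (ival m i P : ℤ) = a ∧ (ret m P : ℤ) = b}.ncard : ℤ))
      = (t + b) * C n a * C (m * n - t - b - 1) (n - t - a - b) := by
  lift m to ℕ using hm.le
  lift n to ℕ using hn.le
  lift t to ℕ using ht.le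
  lift i to ℕ using by omega
  lift a to ℕ using ha
  lift b to ℕ using hb
  have hmn : 2 * n ≤ m * n := Nat.mul_le_mul_right _ (by omega)
  rw [ncard_dyck m n t i a b (by omega) (by omega) (by omega) (by omega), C_natCast,
    show (m : ℤ) * n - t - b - 1 = ((m * n - t - b - 1 : ℕ) : ℤ) by
      rw [← Nat.cast_mul]
      omega,
    show (n : ℤ) - t - a - b = ((n - t - a - b : ℕ) : ℤ) by omega, C_natCast]
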